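/- For every q ∈ [1,∞) there exist c > 0 and R₀ > 2 such that for all R ≥ R₀, all T > 0 and all p ∈ [1,∞): ‖W_R‖_{L^p_T L^q_x} ≥ c·T^{1/p}·R^{(α(n−2)+4γ)/(2q)}. -/

import Mathlib

open MeasureTheory Filter

noncomputable section

/-- Euclidean norm on `Fin m → ℝ`. -/
def euclNorm {m : ℕ} (y : Fin m → ℝ) : ℝ := Real.sqrt (∑ i, y i ^ 2)

/-- For even `m`, the `m × m` block-diagonal matrix with `m/2` diagonal blocks
`σ = ![![0,1],![-1,0]]`. -/
def omegaMat (m : ℕ) : Matrix (Fin m) (Fin m) ℝ := fun i j =>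
  if i.val % 2 = 0 ∧ j.val = i.val + 1 then 1
  else if j.val % 2 = 0 ∧ i.val = j.val + 1 then -1
  else 0

/-- The `n × n` matrix whose upper-left `k × k` block is `Ω_k` and whose remaining
entries vanish. -/
def Mmat (n k : ℕ) : Matrix (Fin n) (Fin n) ℝ := fun i j =>
  if i.val < k ∧ j.val < k then
    (if i.val % 2 = 0 ∧ j.val = i.val + 1 then 1
     else if j.val % 2 = 0 ∧ i.val = j.val + 1 then -1
     else 0)
  else 0

/-- `i`-th partial derivative of a function on `Fin m → ℝ`. -/
def pd {m : ℕ} (f : (Fin m → ℝ) → ℂ) (i : Fin m) (y : Fin m → ℝ) : ℂ :=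
  fderiv ℝ f y (Pi.single i 1)

/-- Laplacian on `Fin m → ℝ`. -/
def lapV {m : ℕ} (f : (Fin m → ℝ) → ℂ) (y : Fin m → ℝ) : ℂ :=
  ∑ i, pd (pd f i) i y

/-- Twisted Laplacian (Landau Hamiltonian)
`T v = -Δv + 2i (Ω_m y)·∇v + |y|² v` on `Fin m → ℝ`. -/
def twistedLap (m : ℕ) (f : (Fin m → ℝ) → ℂ) (y : Fin m → ℝ) : ℂ :=
  - lapV f y + 2 * Complex.I * ∑ i, (((omegaMat m).mulVec y i : ℝ) : ℂ) * pd f i y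
    + ((euclNorm y ^ 2 : ℝ) : ℂ) * f y

/-- `L^q` norm (with real exponent) of a complex-valued function. -/
def LqNorm {X : Type*} [MeasureSpace X] (q : ℝ) (f : X → ℂ) : ℝ :=
  (eLpNorm f (ENNReal.ofReal q) volume).toReal

/-- Mixed norm `‖u‖_{L^p((0,T);L^q)}`. -/
def mixedNorm {X : Type*} [MeasureSpace X] (p q T : ℝ) (u : ℝ → X → ℂ) : ℝ :=
  (∫ t in Set.Ioo (0:ℝ) T, LqNorm q (u t) ^ p) ^ (1/p)

/-- A smooth compactly supported cutoff `ψ` with `0 ≤ ψ ≤ 1`, `ψ s = 0` for `|s| > 1`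
and `ψ s = 1` for `|s| < 1/2`. -/
def IsCutoff (ψ : ℝ → ℝ) : Prop :=
  ContDiff ℝ (⊤ : ℕ∞) ψ ∧ HasCompactSupport ψ ∧ (∀ s, 0 ≤ ψ s ∧ ψ s ≤ 1) ∧
    (∀ s, 1 < |s| → ψ s = 0) ∧ (∀ s, |s| < 1/2 → ψ s = 1)

/-- `v` is a smooth nonzero eigenfunction of the twisted Laplacian on `Fin m → ℝ`
with eigenvalue `lam`, such that `v` and `∇v` lie in every `L^p`, `1 ≤ p < ∞`. -/
def IsEigen (m : ℕ) (lam : ℝ) (v : (Fin m → ℝ) → ℂ) : Prop :=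
  ContDiff ℝ (⊤ : ℕ∞) v ∧ v ≠ 0 ∧ (∀ y, twistedLap m v y = (lam : ℂ) * v y) ∧
    (∀ p : ℝ, 1 ≤ p → MemLp v (ENNReal.ofReal p) volume) ∧
    (∀ p : ℝ, 1 ≤ p → ∀ i, MemLp (pd v i) (ENNReal.ofReal p) volume)

/-- Schrödinger admissibility: `p, q ≥ 2` and `2/p = n/2 - n/q`. -/
def SAdmissible (n : ℕ) (p q : ℝ) : Prop :=
  2 ≤ p ∧ 2 ≤ q ∧ 2 / p = (n : ℝ) / 2 - (n : ℝ) / q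

/-- Euclidean norm of `x = (y,z) ∈ ℝ^{n-2} × ℝ²`. -/
def pairNormE {m : ℕ} (x : (Fin m → ℝ) × (Fin 2 → ℝ)) : ℝ :=
  Real.sqrt (euclNorm x.1 ^ 2 + euclNorm x.2 ^ 2)

/-- `W(t,y,z) = e^{iλt/|z|^α} v(y/|z|^{α/2})` in the even case. -/
def WfunE (m : ℕ) (α lam : ℝ) (v : (Fin m → ℝ) → ℂ) (t : ℝ)
    (x : (Fin m → ℝ) × (Fin 2 → ℝ)) : ℂ :=
  Complex.exp (Complex.I * ((lam * t / euclNorm x.2 ^ α : ℝ) : ℂ))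
    * v (fun i => x.1 i / euclNorm x.2 ^ (α/2))

/-- `W_R(t,y,z) = W(t,y,z) ψ_R¹(z) ψ_R²(z) ψ(|y|²/|z|²)`. -/
def WRfunE (m : ℕ) (α lam : ℝ) (v : (Fin m → ℝ) → ℂ) (ψ : ℝ → ℝ) (γ R : ℝ)
    (t : ℝ) (x : (Fin m → ℝ) × (Fin 2 → ℝ)) : ℂ :=
  WfunE m α lam v t x * ((ψ ((x.2 0 - R) / R ^ γ) : ℝ) : ℂ)
    * ((ψ ((x.2 1 - R) / R ^ γ) : ℝ) : ℂ)
    * ((ψ (euclNorm x.1 ^ 2 / euclNorm x.2 ^ 2) : ℝ) : ℂ)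

/-- Initial datum `f_R = W_R(0,·)` in the even case. -/
def fRfunE (m : ℕ) (α lam : ℝ) (v : (Fin m → ℝ) → ℂ) (ψ : ℝ → ℝ) (γ R : ℝ) :
    (Fin m → ℝ) × (Fin 2 → ℝ) → ℂ :=
  WRfunE m α lam v ψ γ R 0

/-- Partial derivative in the `i`-th `y` direction on `(Fin m → ℝ) × (Fin 2 → ℝ)`. -/
def pdYE {m : ℕ} (f : (Fin m → ℝ) × (Fin 2 → ℝ) → ℂ) (i : Fin m)
    (x : (Fin m → ℝ) × (Fin 2 → ℝ)) : ℂ :=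
  fderiv ℝ f x (Pi.single i 1, 0)

/-- Partial derivative in the `j`-th `z` direction on `(Fin m → ℝ) × (Fin 2 → ℝ)`. -/
def pdZE {m : ℕ} (f : (Fin m → ℝ) × (Fin 2 → ℝ) → ℂ) (j : Fin 2)
    (x : (Fin m → ℝ) × (Fin 2 → ℝ)) : ℂ :=
  fderiv ℝ f x (0, Pi.single j 1)

/-- Full spatial Laplacian on `(Fin m → ℝ) × (Fin 2 → ℝ) ≃ ℝⁿ`. -/
def lapXE {m : ℕ} (f : (Fin m → ℝ) × (Fin 2 → ℝ) → ℂ)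
    (x : (Fin m → ℝ) × (Fin 2 → ℝ)) : ℂ :=
  (∑ i, pdYE (pdYE f i) i x) + ∑ j, pdZE (pdZE f j) j x

/-- Divergence of a vector field on `(Fin m → ℝ) × (Fin 2 → ℝ)`. -/
def divXE {m : ℕ}
    (b : (Fin m → ℝ) × (Fin 2 → ℝ) → (Fin m → ℝ) × (Fin 2 → ℝ))
    (x : (Fin m → ℝ) × (Fin 2 → ℝ)) : ℝ :=
  (∑ i, fderiv ℝ (fun x' => (b x').1 i) x (Pi.single i 1, 0))
    + ∑ j, fderiv ℝ (fun x' => (b x').2 j) x (0, Pi.single j 1)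

/-- `a · ∇u` on `(Fin m → ℝ) × (Fin 2 → ℝ)`. -/
def dotGradE {m : ℕ} (a : (Fin m → ℝ) × (Fin 2 → ℝ))
    (u : (Fin m → ℝ) × (Fin 2 → ℝ) → ℂ) (x : (Fin m → ℝ) × (Fin 2 → ℝ)) : ℂ :=
  (∑ i, ((a.1 i : ℝ) : ℂ) * pdYE u i x) + ∑ j, ((a.2 j : ℝ) : ℂ) * pdZE u j x

/-- Squared Euclidean length of a vector of `(Fin m → ℝ) × (Fin 2 → ℝ)`. -/
def normSqPairE {m : ℕ} (a : (Fin m → ℝ) × (Fin 2 → ℝ)) : ℝ :=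
  euclNorm a.1 ^ 2 + euclNorm a.2 ^ 2

/-- Magnetic operator `(∇ - ia)² u = Δu - 2i a·∇u - i (div a) u - |a|² u`, even case. -/
def magSqE {m : ℕ}
    (a : (Fin m → ℝ) × (Fin 2 → ℝ) → (Fin m → ℝ) × (Fin 2 → ℝ))
    (u : (Fin m → ℝ) × (Fin 2 → ℝ) → ℂ) (x : (Fin m → ℝ) × (Fin 2 → ℝ)) : ℂ :=
  lapXE u x - 2 * Complex.I * dotGradE (a x) u x - Complex.I * ((divXE a x : ℝ) : ℂ) * u x
    - ((normSqPairE (a x) : ℝ) : ℂ) * u x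

/-- The vector field `|z|^{-α} M(y,0,0)ᵗ = |z|^{-α} (Ω_m y, 0, 0)`. -/
def aZE (m : ℕ) (α : ℝ) (x : (Fin m → ℝ) × (Fin 2 → ℝ)) :
    (Fin m → ℝ) × (Fin 2 → ℝ) :=
  (fun i => euclNorm x.2 ^ (-α) * (omegaMat m).mulVec x.1 i, 0)

/-- `F_R = i ∂_t W_R - (∇ - i |z|^{-α} M(y,0,0)ᵗ)² W_R`, even case. -/
def FRfunE (m : ℕ) (α lam : ℝ) (v : (Fin m → ℝ) → ℂ) (ψ : ℝ → ℝ) (γ R : ℝ)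
    (t : ℝ) (x : (Fin m → ℝ) × (Fin 2 → ℝ)) : ℂ :=
  Complex.I * deriv (fun s => WRfunE m α lam v ψ γ R s x) t
    - magSqE (aZE m α) (WRfunE m α lam v ψ γ R t) x

/-- The magnetic potential `A(x) = |x|^{-α} M x = |x|^{-α} (Ω_m y, 0, 0)` in split
coordinates `x = (y,z) ∈ ℝ^{n-2} × ℝ²`. -/
def AsplitE (m : ℕ) (α : ℝ) (x : (Fin m → ℝ) × (Fin 2 → ℝ)) :
    (Fin m → ℝ) × (Fin 2 → ℝ) :=
  (fun i => pairNormE x ^ (-α) * (omegaMat m).mulVec x.1 i, 0)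

/-- Residual `i ∂_t u - Δu + 2i A·∇u + |A|² u`, even case. -/
def residOpE (m : ℕ) (α : ℝ) (u : ℝ → (Fin m → ℝ) × (Fin 2 → ℝ) → ℂ)
    (t : ℝ) (x : (Fin m → ℝ) × (Fin 2 → ℝ)) : ℂ :=
  Complex.I * deriv (fun s => u s x) t - lapXE (u t) x
    + 2 * Complex.I * dotGradE (AsplitE m α x) (u t) x
    + ((normSqPairE (AsplitE m α x) : ℝ) : ℂ) * u t x

/-- Time-truncated residual `F̃_R`, even case. -/
def FtildeRE (m : ℕ) (α lam : ℝ) (v : (Fin m → ℝ) → ℂ) (ψ : ℝ → ℝ)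
    (γ R β : ℝ) (t : ℝ) (x : (Fin m → ℝ) × (Fin 2 → ℝ)) : ℂ :=
  if 0 < t ∧ t < R ^ β then residOpE m α (WRfunE m α lam v ψ γ R) t x else 0

lemma euclNorm_nonneg' {m : ℕ} (y : Fin m → ℝ) : 0 ≤ euclNorm y := Real.sqrt_nonneg _

lemma euclNorm_smul' {m : ℕ} (R : ℝ) (hR : 0 ≤ R) (y : Fin m → ℝ) :
    euclNorm (fun i => R * y i) = R * euclNorm y := by
  unfold euclNorm
  simp only [mul_pow]
  rw [← Finset.mul_sum, Real.sqrt_mul (by positivity), Real.sqrt_sq hR]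

lemma abs_le_euclNorm' {m : ℕ} (y : Fin m → ℝ) (i : Fin m) : |y i| ≤ euclNorm y := by
  unfold euclNorm
  apply Real.abs_le_sqrt
  exact Finset.single_le_sum (f := fun i => y i ^ 2) (fun j _ => sq_nonneg _) (Finset.mem_univ i)

lemma continuous_euclNorm' {m : ℕ} : Continuous (euclNorm : (Fin m → ℝ) → ℝ) := by
  unfold euclNorm
  fun_prop

lemma WR_norm (m : ℕ) (α lam : ℝ) (v : (Fin m → ℝ) → ℂ) (ψ : ℝ → ℝ) (hψ : IsCutoff ψ) (γ R t : ℝ)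
    (x : (Fin m → ℝ) × (Fin 2 → ℝ)) :
    ‖WRfunE m α lam v ψ γ R t x‖ = ‖v (fun i => x.1 i / euclNorm x.2 ^ (α/2))‖
      * ψ ((x.2 0 - R) / R ^ γ) * ψ ((x.2 1 - R) / R ^ γ)
      * ψ (euclNorm x.1 ^ 2 / euclNorm x.2 ^ 2) := by
  unfold WRfunE WfunE
  have h := fun s => (hψ.2.2.1 s).1
  simp only [norm_mul, Complex.norm_real, Real.norm_eq_abs, abs_of_nonneg (h _)]
  rw [mul_comm Complex.I, Complex.norm_exp_ofReal_mul_I, one_mul]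

/-- Time independence and mixed norm. -/
lemma mixedNorm_WR (m : ℕ) (α lam : ℝ) (v : (Fin m → ℝ) → ℂ) (ψ : ℝ → ℝ) (hψ : IsCutoff ψ)
    (γ R q T p : ℝ) (hT : 0 < T) (hp : 1 ≤ p) :
    mixedNorm p q T (WRfunE m α lam v ψ γ R)
      = T ^ (1/p) * LqNorm q (WRfunE m α lam v ψ γ R 0) := by
  have h : ∀ t, LqNorm q (WRfunE m α lam v ψ γ R t) = LqNorm q (WRfunE m α lam v ψ γ R 0) := by
    intro t
    unfold LqNorm
    congr 1
    apply eLpNorm_congr_norm_ae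
    filter_upwards with x
    rw [WR_norm _ _ _ _ _ hψ, WR_norm _ _ _ _ _ hψ]
  have h0 : 0 ≤ LqNorm q (WRfunE m α lam v ψ γ R 0) := ENNReal.toReal_nonneg
  unfold mixedNorm
  simp only [h]
  rw [setIntegral_const]
  simp only [Measure.real, Real.volume_Ioo, sub_zero, ENNReal.toReal_ofReal hT.le, smul_eq_mul]
  rw [Real.mul_rpow hT.le (by positivity), ← Real.rpow_mul h0, mul_one_div_cancel (by linarith),
    Real.rpow_one]

lemma WR_finite (m : ℕ) (α lam : ℝ) (hα : 0 < α) (v : (Fin m → ℝ) → ℂ) (hv : Continuous v)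
    (ψ : ℝ → ℝ) (hψ : IsCutoff ψ)
    (γ R q : ℝ) (hγ2 : γ < 1) (hR : 1 < R) (hq : 1 ≤ q) :
    eLpNorm (WRfunE m α lam v ψ γ R 0) (ENNReal.ofReal q) volume ≠ ⊤ := by
  have hRγ : R ^ γ < R := by
    simpa using Real.rpow_lt_rpow_of_exponent_lt hR hγ2
  have hRγ0 : 0 < R ^ γ := by positivity
  set a := R - R ^ γ with ha
  have ha0 : 0 < a := by linarith
  obtain ⟨C, hC⟩ := (isCompact_closedBall (0 : Fin m → ℝ) (3 * R / a ^ (α/2))).exists_bound_of_continuousOn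
    hv.continuousOn
  set K : Set ((Fin m → ℝ) × (Fin 2 → ℝ)) :=
    Metric.closedBall 0 (3 * R) ×ˢ Metric.closedBall 0 (2 * R) with hK
  have hKm : MeasurableSet K := measurableSet_closedBall.prod measurableSet_closedBall
  have hKfin : volume K ≠ ⊤ := by
    rw [hK, Measure.volume_eq_prod, Measure.prod_prod]
    exact ENNReal.mul_ne_top measure_closedBall_lt_top.ne measure_closedBall_lt_top.ne
  have hsupp : ∀ s, ψ s ≠ 0 → |s| ≤ 1 := fun s hs => by
    by_contra h
    exact hs (hψ.2.2.2.1 s (by linarith))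
  have hle : ∀ x, ‖WRfunE m α lam v ψ γ R 0 x‖ ≤ ‖K.indicator (fun _ => C) x‖ := by
    intro x
    rw [WR_norm _ _ _ _ _ hψ]
    by_cases h1 : ψ ((x.2 0 - R) / R ^ γ) = 0
    · simp [h1]
    by_cases h2 : ψ ((x.2 1 - R) / R ^ γ) = 0
    · simp [h2]
    by_cases h3 : ψ (euclNorm x.1 ^ 2 / euclNorm x.2 ^ 2) = 0
    · simp [h3]
    have e1 := hsupp _ h1
    have e2 := hsupp _ h2
    have e3 := hsupp _ h3
    rw [abs_div, abs_of_pos hRγ0, div_le_one hRγ0, abs_le] at e1 e2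
    have hz : a ≤ euclNorm x.2 := by
      refine le_trans ?_ (abs_le_euclNorm' x.2 0)
      rw [le_abs]; left; linarith [e1.1]
    have hzu : euclNorm x.2 ≤ 3 * R := by
      unfold euclNorm
      rw [Fin.sum_univ_two]
      apply Real.sqrt_le_iff.2
      constructor
      · linarith
      · nlinarith [e1.1, e1.2, e2.1, e2.2]
    have hz0 : 0 < euclNorm x.2 := by linarith
    have hy : euclNorm x.1 ≤ 3 * R := by
      rw [abs_of_nonneg (by positivity), div_le_one (by positivity)] at e3
      exact le_trans (abs_le_of_sq_le_sq' e3 hz0.le).2 hzu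
    have hxK : x ∈ K := by
      constructor
      · rw [mem_closedBall_zero_iff, pi_norm_le_iff_of_nonneg (by linarith)]
        intro i
        exact (abs_le_euclNorm' x.1 i).trans hy
      · rw [mem_closedBall_zero_iff, pi_norm_le_iff_of_nonneg (by linarith)]
        intro i
        rw [Real.norm_eq_abs, abs_le]
        fin_cases i <;> constructor <;> simp <;> linarith [e1.1, e1.2, e2.1, e2.2]
    rw [Set.indicator_of_mem hxK]
    have hvC : ‖v (fun i => x.1 i / euclNorm x.2 ^ (α/2))‖ ≤ C := by
      apply hC
      rw [mem_closedBall_zero_iff, pi_norm_le_iff_of_nonneg (by positivity)]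
      intro i
      rw [Real.norm_eq_abs, abs_div, abs_of_nonneg (by positivity : 0 ≤ euclNorm x.2 ^ (α/2))]
      apply div_le_div₀ (by linarith) ((abs_le_euclNorm' x.1 i).trans hy) (by positivity)
      exact Real.rpow_le_rpow ha0.le hz (by positivity)
    have b := hψ.2.2.1
    calc _ ≤ C * 1 * 1 * 1 := by
          have hC0 : 0 ≤ C := (norm_nonneg _).trans hvC
          gcongr
          all_goals first | exact (b _).1 | exact (b _).2
      _ ≤ ‖C‖ := by simpa using le_abs_self C
  refine ((eLpNorm_mono hle).trans_lt ?_).ne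
  rw [eLpNorm_indicator_const hKm (by simp; linarith) (by simp)]
  exact ENNReal.mul_lt_top (by simp) (ENNReal.rpow_lt_top_of_nonneg (by positivity) hKfin)

lemma WR_lower (m : ℕ) (α lam : ℝ) (hα1 : 1 < α) (hα2 : α < 2) (v : (Fin m → ℝ) → ℂ)
    (hv : Continuous v) (hv0 : v ≠ 0)
    (ψ : ℝ → ℝ) (hψ : IsCutoff ψ)
    (γ q : ℝ) (hγ2 : γ < 1) (hq : 1 ≤ q) :
    ∃ c R₀ : ℝ, 0 < c ∧ 2 < R₀ ∧ ∀ R : ℝ, R₀ ≤ R →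
      c * R ^ ((α * m + 4*γ) / (2*q)) ≤ LqNorm q (WRfunE m α lam v ψ γ R 0) := by
  obtain ⟨y0, hy0⟩ : ∃ y, v y ≠ 0 := Function.ne_iff.1 hv0
  set ζ0 : Fin 2 → ℝ := fun _ => 1 with hζ0
  have hζ0n : 0 < euclNorm ζ0 := lt_of_lt_of_le (by simp [hζ0]) (abs_le_euclNorm' ζ0 0)
  set w0 : Fin m → ℝ := fun i => y0 i * euclNorm ζ0 ^ (α/2) with hw0
  set δ := ‖v y0‖ / 2 with hδ
  have hδ0 : 0 < δ := by have := norm_pos_iff.2 hy0; positivity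
  set Kc := euclNorm w0 ^ 2 / euclNorm ζ0 ^ 2 + 1 with hKc
  have hKc0 : 0 < Kc := by positivity
  have hcn : Continuous fun x : (Fin m → ℝ) × (Fin 2 → ℝ) => euclNorm x.2 :=
    continuous_euclNorm'.comp continuous_snd
  have hcn1 : Continuous fun x : (Fin m → ℝ) × (Fin 2 → ℝ) => euclNorm x.1 :=
    continuous_euclNorm'.comp continuous_fst
  have c1 : ContinuousAt (fun x : (Fin m → ℝ) × (Fin 2 → ℝ) =>
      ‖v (fun i => x.1 i / euclNorm x.2 ^ (α/2))‖) (w0, ζ0) := by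
    apply ContinuousAt.norm
    apply hv.continuousAt.comp
    apply continuousAt_pi.2
    intro i
    apply ContinuousAt.div
    · fun_prop
    · exact hcn.continuousAt.rpow_const (Or.inl hζ0n.ne')
    · exact (Real.rpow_pos_of_pos hζ0n _).ne'
  have c2 : ContinuousAt (fun x : (Fin m → ℝ) × (Fin 2 → ℝ) =>
      euclNorm x.1 ^ 2 / euclNorm x.2 ^ 2) (w0, ζ0) := by
    apply ContinuousAt.div
    · exact (hcn1.pow 2).continuousAt
    · exact (hcn.pow 2).continuousAt
    · exact (pow_pos hζ0n 2).ne'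
  have n1 : ∀ᶠ x in nhds (w0, ζ0), δ < ‖v (fun i => x.1 i / euclNorm x.2 ^ (α/2))‖ := by
    apply c1.eventually_const_lt
    have : (fun i => w0 i / euclNorm ζ0 ^ (α/2)) = y0 := by
      ext i
      exact mul_div_cancel_right₀ _ (Real.rpow_pos_of_pos hζ0n _).ne'
    simp only [this]
    have := norm_pos_iff.2 hy0
    linarith
  have n2 : ∀ᶠ x in nhds (w0, ζ0), euclNorm x.1 ^ 2 / euclNorm x.2 ^ 2 < Kc := by
    apply c2.eventually_lt_const
    simp [hKc]
  obtain ⟨ε, hε, hball⟩ := Metric.eventually_nhds_iff.1 (n1.and n2)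
  -- largeness
  have L1 : ∀ᶠ R : ℝ in atTop, R ^ (γ - 1) < ε := by
    have := tendsto_rpow_neg_atTop (show 0 < 1 - γ by linarith)
    simp only [neg_sub] at this
    exact this.eventually_lt_const hε
  have L2 : ∀ᶠ R : ℝ in atTop, R ^ (α - 2) < 1 / (2 * Kc) := by
    have := tendsto_rpow_neg_atTop (show 0 < 2 - α by linarith)
    simp only [neg_sub] at this
    exact this.eventually_lt_const (by positivity)
  obtain ⟨R₁, hR₁⟩ := eventually_atTop.1 (L1.and L2)
  refine ⟨δ * ((2 * ε) ^ m) ^ (1/q), max R₁ 3, by positivity, lt_of_lt_of_le (by norm_num) (le_max_right _ _), ?_⟩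
  intro R hR
  have hR3 : 3 ≤ R := (le_max_right _ _).trans hR
  have hR0 : 0 < R := by linarith
  obtain ⟨l1, l2⟩ := hR₁ R ((le_max_left _ _).trans hR)
  have hRγ0 : 0 < R ^ γ := by positivity
  set s := R ^ (α/2) with hs
  have hs0 : 0 < s := by positivity
  set S : Set ((Fin m → ℝ) × (Fin 2 → ℝ)) :=
    Metric.ball (fun i => s * w0 i) (s * ε) ×ˢ Metric.ball (fun _ => R) (R ^ γ / 2) with hS
  have hSm : MeasurableSet S := measurableSet_ball.prod measurableSet_ball
  have hSvol : volume S = ENNReal.ofReal ((2 * (s * ε)) ^ m * (R ^ γ) ^ 2) := by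
    rw [hS, Measure.volume_eq_prod, Measure.prod_prod, Real.volume_pi_ball _ (by positivity),
      Real.volume_pi_ball _ (by positivity), ← ENNReal.ofReal_mul (by positivity)]
    simp only [Fintype.card_fin]
    congr 3
    ring
  have hle : ∀ x, ‖S.indicator (fun _ => δ) x‖ ≤ ‖WRfunE m α lam v ψ γ R 0 x‖ := by
    intro x
    by_cases hx : x ∈ S
    swap
    · simp [hx]
    rw [Set.indicator_of_mem hx, WR_norm _ _ _ _ _ hψ]
    obtain ⟨hx1, hx2⟩ := hx
    rw [Metric.mem_ball, dist_pi_lt_iff (by positivity)] at hx1 hx2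
    simp only [Real.dist_eq] at hx1 hx2
    have hψz : ∀ j, ψ ((x.2 j - R) / R ^ γ) = 1 := by
      intro j
      apply hψ.2.2.2.2
      rw [abs_div, abs_of_pos hRγ0, div_lt_iff₀ hRγ0]
      linarith [hx2 j]
    set w : Fin m → ℝ := fun i => x.1 i / s with hw
    set ζ : Fin 2 → ℝ := fun j => x.2 j / R with hζ
    have ew : x.1 = fun i => s * w i := by
      ext i; simp only [hw]; field_simp
    have eζ : x.2 = fun i => R * ζ i := by
      ext i; simp only [hζ]; field_simp
    have hd : dist (w, ζ) (w0, ζ0) < ε := by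
      rw [Prod.dist_eq, max_lt_iff]
      constructor
      · rw [dist_pi_lt_iff hε]
        intro i
        have := hx1 i
        rw [ew] at this
        simp only [← mul_sub, abs_mul, abs_of_pos hs0] at this
        exact lt_of_mul_lt_mul_left this hs0.le
      · rw [dist_pi_lt_iff hε]
        intro i
        have h := hx2 i
        rw [eζ] at h
        have e : R * ζ i - R = R * (ζ i - ζ0 i) := by simp [hζ0]; ring
        rw [e, abs_mul, abs_of_pos hR0] at h
        rw [Real.rpow_sub hR0, Real.rpow_one, div_lt_iff₀ hR0] at l1
        refine lt_of_mul_lt_mul_left (a := R) ?_ hR0.le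
        rw [Real.dist_eq]
        nlinarith
    obtain ⟨b1, b2⟩ := hball hd
    simp only at b1 b2
    have hEz : euclNorm x.2 = R * euclNorm ζ := by
      conv_lhs => rw [eζ]
      exact euclNorm_smul' R hR0.le ζ
    have hEy : euclNorm x.1 = s * euclNorm w := by
      conv_lhs => rw [ew]
      exact euclNorm_smul' s hs0.le w
    have hv1 : (fun i => x.1 i / euclNorm x.2 ^ (α/2)) = fun i => w i / euclNorm ζ ^ (α/2) := by
      ext i
      rw [hEz, Real.mul_rpow hR0.le (euclNorm_nonneg' _), ← hs, ← div_div]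
    have hψ3 : ψ (euclNorm x.1 ^ 2 / euclNorm x.2 ^ 2) = 1 := by
      apply hψ.2.2.2.2
      rw [abs_of_nonneg (by positivity), hEz, hEy, mul_pow, mul_pow, mul_div_mul_comm]
      have e : s ^ 2 / R ^ 2 = R ^ (α - 2) := by
        rw [hs, ← Real.rpow_natCast, ← Real.rpow_mul hR0.le, Real.rpow_sub hR0]
        norm_num
      rw [e]
      calc R ^ (α - 2) * (euclNorm w ^ 2 / euclNorm ζ ^ 2) ≤ R ^ (α - 2) * Kc := by gcongr
        _ < 1 / (2 * Kc) * Kc := by gcongr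
        _ = 1 / 2 := by field_simp
    rw [hψz, hψz, hψ3, hv1, Real.norm_eq_abs, abs_of_pos hδ0]
    linarith
  have hfin := WR_finite m α lam (by linarith) v hv ψ hψ γ R q hγ2 (by linarith) hq
  have key := ENNReal.toReal_mono hfin (eLpNorm_mono hle (p := ENNReal.ofReal q) (μ := volume))
  rw [eLpNorm_indicator_const hSm (by simp; linarith) (by simp), hSvol,
    ENNReal.toReal_ofReal (by linarith), ENNReal.ofReal_rpow_of_nonneg (by positivity) (by positivity),
    ENNReal.toReal_mul, ENNReal.toReal_ofReal (by positivity)] at key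
  simp only [toReal_enorm, Real.norm_eq_abs, abs_of_pos hδ0] at key
  unfold LqNorm
  refine le_trans (le_of_eq ?_) key
  rw [mul_assoc]
  congr 1
  have e : (2 * (s * ε)) ^ m * (R ^ γ) ^ 2 = (2 * ε) ^ m * R ^ ((α * m + 4 * γ) / 2) := by
    have e1 : R ^ ((α * m + 4 * γ) / 2) = s ^ m * (R ^ γ) ^ 2 := by
      rw [hs, ← Real.rpow_natCast (R ^ (α/2)), ← Real.rpow_natCast (R ^ γ), ← Real.rpow_mul hR0.le,
        ← Real.rpow_mul hR0.le, ← Real.rpow_add hR0]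
      congr 1
      push_cast
      ring
    rw [e1, mul_pow, mul_pow, mul_pow]
    ring
  rw [e, Real.mul_rpow (by positivity) (by positivity), ← Real.rpow_mul hR0.le]
  congr 2
  field_simp

/-- `‖W_R‖_{L^p_T L^q_x} ≥ c T^{1/p} R^{(α(n-2)+4γ)/(2q)}`, even case. -/
theorem WR_lower_bound_even (n : ℕ) (hn : 4 ≤ n) (heven : Even n)
    (α : ℝ) (hα1 : 1 < α) (hα2 : α < 2)
    (lam : ℝ) (v : (Fin (n-2) → ℝ) → ℂ) (hv : IsEigen (n-2) lam v)
    (ψ : ℝ → ℝ) (hψ : IsCutoff ψ) (γ : ℝ) (hγ1 : 1/2 < γ) (hγ2 : γ < 1)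
    (q : ℝ) (hq : 1 ≤ q) :
    ∃ c R₀ : ℝ, 0 < c ∧ 2 < R₀ ∧ ∀ R : ℝ, R₀ ≤ R → ∀ T : ℝ, 0 < T → ∀ p : ℝ, 1 ≤ p →
      c * T ^ (1/p) * R ^ ((α * ((n:ℝ) - 2) + 4*γ) / (2*q)) ≤
        mixedNorm p q T (WRfunE (n-2) α lam v ψ γ R) := by

  obtain ⟨c, R₀, hc, hR₀, H⟩ := WR_lower (n-2) α lam hα1 hα2 v hv.1.continuous hv.2.1 ψ hψ γ q hγ2 hq
  refine ⟨c, R₀, hc, hR₀, fun R hR T hT p hp => ?_⟩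
  rw [mixedNorm_WR _ _ _ _ _ hψ _ _ _ _ _ hT hp]
  have h := H R hR
  rw [Nat.cast_sub (by omega)] at h
  push_cast at h
  calc _ = T ^ (1/p) * (c * R ^ ((α * ((n:ℝ) - 2) + 4*γ) / (2*q))) := by ring
    _ ≤ _ := by gcongr
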